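/- The number of words over the alphabet {R, U, D} consisting of exactly k letters R, k letters U, and n − k letters D, whose first letter is not D, equals binomial(n + k − 1, k − 1) · binomial(n − 1, k) + binomial(n + k, k) · binomial(n − 1, k − 1). (Here binomial(a, b) = 0 when b > a.) -/

import Mathlib

inductive Letter : Type
  | R | U | D
deriving DecidableEq

/-- Prepending `x` to the words with letter counts `g` gives the words starting with `x` whose
letter counts are `g`, with one additional `x`. -/
lemma image_cons_setOf_count {α : Type*} [DecidableEq α] (x : α) (f g : α → ℕ)
    (hx : f x = g x + 1) (hne : ∀ y, y ≠ x → f y = g y) :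
    {w : List α | (∀ y, w.count y = f y) ∧ w.head? = some x} =
      List.cons x '' {w : List α | ∀ y, w.count y = g y} := by
  ext w
  simp only [Set.mem_ofPred_eq, Set.mem_image]
  constructor
  · rintro ⟨hw, hh⟩
    cases w with
    | nil => simp at hh
    | cons a t =>
      obtain rfl : a = x := by simpa using hh
      refine ⟨t, fun y => ?_, rfl⟩
      have hy := hw y
      by_cases hya : y = a
      · subst hya
        simp only [List.count_cons_self] at hy
        omega
      · rw [List.count_cons_of_ne (Ne.symm hya), hne y hya] at hy
        exact hy
  · rintro ⟨t, ht, rfl⟩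
    refine ⟨fun y => ?_, rfl⟩
    by_cases hyx : y = x
    · subst hyx
      simp [ht, hx]
    · rw [List.count_cons_of_ne (Ne.symm hyx), hne y hyx, ht]

/-- If the words with every letter count vector of total `m` are counted by multinomial
coefficients, then so are the words of length `m + 1` with a given first letter. -/
lemma finite_and_ncard_setOf_count_head_of_forall {α : Type*} [DecidableEq α] [Fintype α] (m : ℕ)
    (ih : ∀ g : α → ℕ, ∑ y, g y = m → {w : List α | ∀ y, w.count y = g y}.Finite ∧
      {w : List α | ∀ y, w.count y = g y}.ncard * ∏ y, (g y).factorial = m.factorial)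
    (x : α) (f : α → ℕ) (hf : ∑ y, f y = m + 1) :
    {w : List α | (∀ y, w.count y = f y) ∧ w.head? = some x}.Finite ∧
      {w : List α | (∀ y, w.count y = f y) ∧ w.head? = some x}.ncard * ∏ y, (f y).factorial =
        f x * m.factorial := by
  by_cases h0 : f x = 0
  · have hempty : {w : List α | (∀ y, w.count y = f y) ∧ w.head? = some x} = ∅ := by
      ext w
      simp only [Set.mem_ofPred_eq, Set.mem_empty_iff_false, iff_false, not_and]
      intro hw hh
      have hx := hw x
      rw [h0, List.count_eq_zero] at hx
      exact hx (List.mem_of_mem_head? hh)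
    simp [hempty, h0]
  · obtain ⟨c, hc⟩ := Nat.exists_eq_succ_of_ne_zero h0
    have hne : ∀ y, y ≠ x → f y = Function.update f x c y := fun y hy => by simp [hy]
    have hrest := image_cons_setOf_count x f (Function.update f x c) (by simp [hc]) hne
    have hsum : ∑ y, Function.update f x c y = m := by
      rw [← Finset.add_sum_erase _ _ (Finset.mem_univ x)] at hf ⊢
      have hcongr : ∑ y ∈ Finset.univ.erase x, f y =
          ∑ y ∈ Finset.univ.erase x, Function.update f x c y :=
        Finset.sum_congr rfl fun y hy => hne y (Finset.ne_of_mem_erase hy)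
      simp only [Function.update_self]
      omega
    have hprod : ∏ y, (f y).factorial = f x * ∏ y, (Function.update f x c y).factorial := by
      rw [← Finset.mul_prod_erase _ _ (Finset.mem_univ x),
        ← Finset.mul_prod_erase _ (fun y => (Function.update f x c y).factorial)
          (Finset.mem_univ x),
        Finset.prod_congr rfl fun y hy => by rw [hne y (Finset.ne_of_mem_erase hy)]]
      simp only [Function.update_self, hc, Nat.succ_eq_add_one, Nat.factorial_succ]
      ring
    obtain ⟨hfin, hcard⟩ := ih _ hsum
    rw [hrest, Set.ncard_image_of_injective _ List.cons_injective, hprod]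
    refine ⟨hfin.image _, ?_⟩
    rw [← hcard]
    ring

/-- The number of words with prescribed letter counts is a multinomial coefficient. -/
lemma finite_and_ncard_setOf_count {α : Type*} [DecidableEq α] [Fintype α] (m : ℕ) :
    ∀ f : α → ℕ, ∑ y, f y = m → {w : List α | ∀ y, w.count y = f y}.Finite ∧
      {w : List α | ∀ y, w.count y = f y}.ncard * ∏ y, (f y).factorial = m.factorial := by
  induction m with
  | zero =>
    intro f hf
    have hf0 : ∀ y, f y = 0 := by simpa using hf
    have hnil : {w : List α | ∀ y, w.count y = f y} = {[]} := by
      ext w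
      simp only [hf0, List.count_eq_zero, Set.mem_ofPred_eq, Set.mem_singleton_iff]
      exact List.eq_nil_iff_forall_not_mem.symm
    rw [hnil]
    simp [hf0]
  | succ m ih =>
    intro f hf
    have hhead := fun x => finite_and_ncard_setOf_count_head_of_forall m ih x f hf
    have hunion : {w : List α | ∀ y, w.count y = f y} =
        ⋃ x, {w : List α | (∀ y, w.count y = f y) ∧ w.head? = some x} := by
      ext w
      simp only [Set.mem_ofPred_eq, Set.mem_iUnion, exists_and_left]
      refine ⟨fun hw => ⟨hw, ?_⟩, And.left⟩
      cases w with
      | nil =>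
        simp only [List.count_nil] at hw
        simp [← hw] at hf
      | cons a t => exact ⟨a, rfl⟩
    have hdisj : Pairwise (Function.onFun Disjoint
        fun x => {w : List α | (∀ y, w.count y = f y) ∧ w.head? = some x}) := by
      intro x y hxy
      refine Set.disjoint_left.mpr fun w hwx hwy => hxy ?_
      exact Option.some_injective _ (hwx.2.symm.trans hwy.2)
    rw [hunion]
    refine ⟨Set.finite_iUnion fun x => (hhead x).1, ?_⟩
    rw [Set.ncard_iUnion_of_finite (fun x => (hhead x).1) hdisj, finsum_eq_sum_of_fintype,
      Finset.sum_mul, Finset.sum_congr rfl fun x _ => (hhead x).2, ← Finset.sum_mul, hf,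
      Nat.factorial_succ]

/-- The words with given first letter and prescribed letter counts are counted by a multinomial
coefficient. -/
lemma finite_and_ncard_setOf_count_head {α : Type*} [DecidableEq α] [Fintype α] (m : ℕ)
    (x : α) (f : α → ℕ) (hf : ∑ y, f y = m + 1) :
    {w : List α | (∀ y, w.count y = f y) ∧ w.head? = some x}.Finite ∧
      {w : List α | (∀ y, w.count y = f y) ∧ w.head? = some x}.ncard * ∏ y, (f y).factorial =
        f x * m.factorial :=
  finite_and_ncard_setOf_count_head_of_forall m (finite_and_ncard_setOf_count m) x f hf

lemma choose_mul_choose_add_mul_factorials (j m : ℕ) :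
    ((2 * j + m + 1).choose j * (j + m).choose (j + 1) +
        (2 * j + m + 2).choose (j + 1) * (j + m).choose j) *
      ((j + 1).factorial * (j + 1).factorial * m.factorial) =
      2 * (j + 1) * (2 * j + m + 1).factorial := by
  have h₁ := Nat.choose_succ_right_eq (j + m) j
  rw [Nat.add_sub_cancel_left] at h₁
  have h₂ := Nat.add_one_mul_choose_eq (2 * j + m + 1) j
  have h₃ := Nat.choose_mul_factorial_mul_factorial (show j ≤ 2 * j + m + 1 by omega)
  rw [show 2 * j + m + 1 - j = j + m + 1 by omega, Nat.factorial_succ (j + m)] at h₃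
  have h₄ := Nat.choose_mul_factorial_mul_factorial (show j ≤ j + m by omega)
  rw [Nat.add_sub_cancel_left] at h₄
  rw [← h₃, ← h₄, Nat.factorial_succ j]
  linear_combination
    (2 * j + m + 1).choose j * (j + 1) * j.factorial * j.factorial * m.factorial * h₁ -
      (j + m).choose j * (j + 1) * j.factorial * j.factorial * m.factorial * h₂

instance : Fintype Letter where
  elems := {Letter.R, Letter.U, Letter.D}
  complete x := by cases x <;> simp

lemma Letter.univ_eq : (Finset.univ : Finset Letter) = {Letter.R, Letter.U, Letter.D} := rfl

open Letter in
/-- The number of words over {R, U, D} with exactly `k` letters R, `k` letters U and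
`n - k` letters D, whose first letter is not D, equals
`(n + k - 1).choose (k - 1) * (n - 1).choose k + (n + k).choose k * (n - 1).choose (k - 1)`. -/
theorem stmt_2 (n k : ℕ) (hk : 1 ≤ k) (hkn : k ≤ n) :
    Set.ncard {w : List Letter |
        w.count R = k ∧ w.count U = k ∧ w.count D = n - k ∧ w.head? ≠ some D} =
      (n + k - 1).choose (k - 1) * (n - 1).choose k
        + (n + k).choose k * (n - 1).choose (k - 1) := by
  obtain ⟨j, rfl⟩ := Nat.exists_eq_add_of_le' hk
  obtain ⟨m, rfl⟩ := Nat.exists_eq_add_of_le hkn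
  let f : Letter → ℕ := fun x => match x with
    | R => j + 1
    | U => j + 1
    | D => m
  have hf : ∑ y, f y = (2 * j + m + 1) + 1 := by
    simp [Letter.univ_eq, f]
    ring
  have hprod : ∏ y, (f y).factorial =
      (j + 1).factorial * (j + 1).factorial * m.factorial := by
    simp [Letter.univ_eq, f, mul_assoc]
  obtain ⟨hRfin, hR⟩ := finite_and_ncard_setOf_count_head _ R f hf
  obtain ⟨hUfin, hU⟩ := finite_and_ncard_setOf_count_head _ U f hf
  rw [hprod] at hR hU
  have hunion : {w : List Letter | w.count R = j + 1 ∧ w.count U = j + 1 ∧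
      w.count D = j + 1 + m - (j + 1) ∧ w.head? ≠ some D} =
      {w | (∀ y, w.count y = f y) ∧ w.head? = some R} ∪
        {w | (∀ y, w.count y = f y) ∧ w.head? = some U} := by
    ext w
    have hcount : (∀ y, w.count y = f y) ↔
        w.count R = j + 1 ∧ w.count U = j + 1 ∧ w.count D = m :=
      ⟨fun h => ⟨h R, h U, h D⟩, fun ⟨h₁, h₂, h₃⟩ y => by cases y <;> assumption⟩
    simp only [Set.mem_ofPred_eq, Set.mem_union, hcount, Nat.add_sub_cancel_left]
    rcases w with _ | ⟨a, t⟩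
    · simp
    · cases a <;> simp
  have hdisj : Disjoint {w : List Letter | (∀ y, w.count y = f y) ∧ w.head? = some R}
      {w | (∀ y, w.count y = f y) ∧ w.head? = some U} := by
    refine Set.disjoint_left.mpr fun w hwR hwU => ?_
    simpa using hwR.2.symm.trans hwU.2
  rw [hunion, Set.ncard_union_eq hdisj hRfin hUfin]
  have hpos : 0 < (j + 1).factorial * (j + 1).factorial * m.factorial := by positivity
  refine Nat.eq_of_mul_eq_mul_right hpos ?_
  rw [add_mul, hR, hU, show j + 1 + m + (j + 1) - 1 = 2 * j + m + 1 by omega,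
    show j + 1 + m + (j + 1) = 2 * j + m + 2 by omega, show j + 1 + m - 1 = j + m by omega,
    Nat.add_sub_cancel, choose_mul_choose_add_mul_factorials]
  ring
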